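/- Let F be a totally real number field of degree N and β ∈ O_F a nonzero algebraic integer. Then Tr_{F/ℚ}(β^2) ≥ c_N · Δ_{F/ℚ}(β)^{2/(N^2−N)}, where c_N = (N^2−N)/(2^2·3^3·4^4⋯N^N)^{2/(N^2−N)} and Δ_{F/ℚ}(β) is the discriminant of β (the square of the Vandermonde determinant of the conjugates of β). -/

import Mathlib

open Polynomial Finset in
lemma aux_laguerre {ι : Type*} (s : Finset ι) (x : ι → ℝ) (t : ℝ) :
    0 ≤ (derivative (Lagrange.nodal s x)).eval t ^ 2 -
      (Lagrange.nodal s x).eval t * (derivative (derivative (Lagrange.nodal s x))).eval t := by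
  classical
  induction s using Finset.induction_on with
  | empty => simp
  | insert a s ha ih =>
    rw [Lagrange.nodal_insert_eq_nodal ha]
    simp only [derivative_mul, derivative_sub, derivative_X, derivative_C, eval_add, eval_mul,
      eval_sub, eval_X, eval_C, sub_zero, eval_one, one_mul, derivative_add, derivative_one, zero_add]
    nlinarith [sq_nonneg ((Lagrange.nodal s x).eval t), mul_nonneg (sq_nonneg (t - x a)) ih]

open Polynomial Finset in
lemma aux_coeff1 (n : ℕ) (x : Fin (n + 1) → ℝ) :
    (Lagrange.nodal univ x).coeff n = - ∑ i, x i := by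
  have := prod_X_sub_C_coeff_card_pred (univ : Finset (Fin (n+1))) x (by simp)
  simpa [Lagrange.nodal] using this

open Polynomial Finset in
lemma aux_coeff2 (n : ℕ) (x : Fin (n + 2) → ℝ) :
    (Lagrange.nodal univ x).coeff n = ((∑ i, x i) ^ 2 - ∑ i, x i ^ 2) / 2 := by
  induction n with
  | zero =>
    simp [Lagrange.nodal, Fin.prod_univ_two, Fin.sum_univ_two, coeff_zero_eq_eval_zero]
    ring
  | succ n ih =>
    have h1 := aux_coeff1 (n+1) (fun i => x i.succ)
    have h2 := ih (fun i => x i.succ)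
    have : Lagrange.nodal univ x = (X - C (x 0)) * Lagrange.nodal univ (fun i : Fin (n+2) => x i.succ) := by
      simp [Lagrange.nodal, Fin.prod_univ_succ]
    rw [this, sub_mul, coeff_sub, coeff_X_mul, coeff_C_mul, h1, h2, Fin.sum_univ_succ x,
      Fin.sum_univ_succ (fun i => x i ^ 2)]
    ring

lemma aux_amgm (n : ℕ) (d : Fin (n+1) → ℝ) (hd : ∀ i, 0 ≤ d i) :
    ∏ i, d i ≤ ((∑ i, d i) / (n+1)) ^ (n+1) := by
  have h := Real.geom_mean_le_arith_mean Finset.univ (fun _ => (1:ℝ)) d (by simp) (by simp; positivity)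
    (fun i _ => hd i)
  simp at h
  have hp : 0 ≤ ∏ i, d i := Finset.prod_nonneg fun i _ => hd i
  calc ∏ i, d i = ((∏ i, d i) ^ ((n:ℝ)+1)⁻¹) ^ (n+1) := by
        have := Real.rpow_inv_natCast_pow hp (Nat.succ_ne_zero n)
        push_cast at this
        exact this.symm
    _ ≤ _ := by gcongr

open Polynomial Finset in
lemma aux_rolle (n : ℕ) (x : Fin (n + 2) → ℝ) (hx : StrictMono x) :
    ∃ z : Fin (n + 1) → ℝ, StrictMono z ∧
      derivative (Lagrange.nodal univ x) = C ((n : ℝ) + 2) * Lagrange.nodal univ z := by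
  have key : ∀ k : Fin (n+1), ∃ c ∈ Set.Ioo (x k.castSucc) (x k.succ),
      (derivative (Lagrange.nodal univ x)).eval c = 0 := by
    intro k
    have := exists_hasDerivAt_eq_zero (f := fun t => (Lagrange.nodal univ x).eval t)
      (f' := fun t => (derivative (Lagrange.nodal univ x)).eval t)
      (hx (Fin.castSucc_lt_succ (i := k))) (Polynomial.continuous _).continuousOn
      (by simp [Lagrange.eval_nodal_at_node]) (fun t _ => Polynomial.hasDerivAt _ t)
    exact this
  choose z hz hz0 using key
  have hzm : StrictMono z := by
    rw [Fin.strictMono_iff_lt_succ]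
    intro i
    have h1 := (hz i.castSucc).2
    have h2 := (hz i.succ).1
    rw [Fin.succ_castSucc] at h1
    exact h1.trans h2
  refine ⟨z, hzm, ?_⟩
  have hmon : (Lagrange.nodal univ x).Monic := Lagrange.nodal_monic
  have hdeg : (Lagrange.nodal univ x).natDegree = n + 2 := by simp
  have hmon2 : (Lagrange.nodal univ z).Monic := Lagrange.nodal_monic
  have hdeg2 : (Lagrange.nodal univ z).natDegree = n + 1 := by simp
  rw [← sub_eq_zero]
  apply Polynomial.eq_zero_of_degree_lt_of_eval_index_eq_zero (v := z) univ hzm.injective.injOn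
  · rw [Polynomial.degree_lt_iff_coeff_zero]
    intro m hm
    have hm : n + 1 ≤ m := by simpa using hm
    rw [coeff_sub, coeff_derivative, coeff_C_mul]
    rcases eq_or_lt_of_le hm with rfl | hm
    · have h1 := hmon.coeff_natDegree
      have h2 := hmon2.coeff_natDegree
      rw [hdeg] at h1
      rw [hdeg2] at h2
      rw [h1, h2]; push_cast; ring
    · rw [coeff_eq_zero_of_natDegree_lt (by omega), coeff_eq_zero_of_natDegree_lt (by omega)]
      simp
  · intro i _
    simp [hz0, Lagrange.eval_nodal_at_node]

open Polynomial Finset in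
lemma aux_step (n : ℕ) (x : Fin (n + 2) → ℝ) (hx : StrictMono x) (h0 : ∑ i, x i = 0) :
    ∃ z : Fin (n + 1) → ℝ, StrictMono z ∧ ∑ i, z i = 0 ∧
      (n + 2 : ℝ) * (∑ i, z i ^ 2) = n * ∑ i, x i ^ 2 ∧
      ∏ i, |(derivative (Lagrange.nodal univ x)).eval (x i)| ≤
        (n + 2 : ℝ) ^ (n + 2) * ((∑ i, x i ^ 2) / ((n + 2) * (n + 1))) ^ (n + 1) *
          ∏ i, |(derivative (Lagrange.nodal univ z)).eval (z i)| := by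
  obtain ⟨z, hz, hd⟩ := aux_rolle n x hx
  have hN : (0 : ℝ) < n + 2 := by positivity
  have hc1 := aux_coeff1 (n+1) x
  have hc2 := aux_coeff2 n x
  have hz1 := aux_coeff1 n z
  have hz0 : ∑ i, z i = 0 := by
    have := congrArg (fun p => p.coeff n) hd
    simp only [coeff_derivative, coeff_C_mul, hc1, hz1, h0] at this
    simp at this
    rcases this with h | h
    · linarith
    · exact h
  refine ⟨z, hz, hz0, ?_, ?_⟩
  · rcases n with _ | n
    · simp at hz0 ⊢
      exact hz0
    · have := congrArg (fun p => p.coeff n) hd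
      simp only [coeff_derivative, coeff_C_mul, hc2, aux_coeff2 n z, h0, hz0] at this
      push_cast at this ⊢
      linarith
  set P := Lagrange.nodal univ x with hP
  set Q := Lagrange.nodal univ z with hQ
  set S := ∑ i, x i ^ 2 with hS
  have hQe : ∀ k, (derivative Q).eval (z k) = ∏ j ∈ univ.erase k, (z k - z j) := by
    intro k
    rw [hQ, Lagrange.eval_nodal_derivative_eval_node_eq (mem_univ k), Lagrange.eval_nodal]
  have hQne : ∀ k, (derivative Q).eval (z k) ≠ 0 := by
    intro k
    rw [hQe, prod_ne_zero_iff]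
    intro j hj
    exact sub_ne_zero.2 (hz.injective.ne (ne_of_mem_erase hj).symm)
  let d : Fin (n+1) → ℝ := fun k => - P.eval (z k) / (derivative Q).eval (z k)
  have hdd : ∀ k, d k = - P.eval (z k) / (derivative Q).eval (z k) := fun _ => rfl
  have hd0 : ∀ k, 0 ≤ d k := by
    intro k
    have h := aux_laguerre univ x (z k)
    rw [← hP, hd] at h
    have e0 : Q.eval (z k) = 0 := Lagrange.eval_nodal_at_node (mem_univ k)
    simp [e0] at h
    have h2 : P.eval (z k) * (derivative Q).eval (z k) ≤ 0 := by
      by_contra hcon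
      push Not at hcon
      nlinarith [mul_pos hN hcon]
    have : d k = -(P.eval (z k) * (derivative Q).eval (z k)) / ((derivative Q).eval (z k))^2 := by
      rw [hdd]; field_simp [hQne k]
    rw [this]
    exact div_nonneg (by linarith) (sq_nonneg _)
  have hPd : ∀ k, |P.eval (z k)| = d k * |(derivative Q).eval (z k)| := by
    intro k
    rw [← abs_of_nonneg (hd0 k), ← abs_mul, hdd, div_mul_cancel₀ _ (hQne k), abs_neg]
  have hmon : P.Monic := Lagrange.nodal_monic
  have hdeg : P.natDegree = n + 2 := by simp [hP]
  have hmon2 : Q.Monic := Lagrange.nodal_monic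
  have hdeg2 : Q.natDegree = n + 1 := by simp [hQ]
  have hsum : ∑ k, d k = S / (n + 2) := by
    have hlt : (P - X * Q).degree < ((#(univ : Finset (Fin (n+1))) : ℕ) : WithBot ℕ) := by
      rw [Polynomial.degree_lt_iff_coeff_zero]
      intro m hm
      simp at hm
      obtain ⟨m, rfl⟩ : ∃ l, m = l + 1 := ⟨m - 1, by omega⟩
      rw [coeff_sub, coeff_X_mul]
      have hm' : n ≤ m := by omega
      rcases eq_or_lt_of_le hm' with rfl | hm
      · rw [hc1, hz1, h0, hz0]; simp
      · rcases eq_or_lt_of_le (Nat.succ_le_of_lt hm) with rfl | hm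
        · have h1 := hmon.coeff_natDegree
          have h2 := hmon2.coeff_natDegree
          rw [hdeg] at h1
          rw [hdeg2] at h2
          simp only [Nat.succ_eq_add_one]
          rw [h1, h2]; ring
        · rw [coeff_eq_zero_of_natDegree_lt (by omega), coeff_eq_zero_of_natDegree_lt (by omega)]
          simp
    have hco := Lagrange.coeff_eq_sum hz.injective.injOn hlt
    have hX : (n + 2 : ℝ) * (X * Q).coeff n = n * P.coeff n := by
      rw [← coeff_C_mul, mul_left_comm, ← hd]
      rcases n with _ | n
      · simp
      · rw [coeff_X_mul, coeff_derivative]; push_cast; ring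
    have e : ∑ k, d k = - (P - X * Q).coeff n := by
      simp at hco
      rw [coeff_sub, hco, ← sum_neg_distrib]
      refine sum_congr rfl fun k _ => ?_
      have e0 : Q.eval (z k) = 0 := Lagrange.eval_nodal_at_node (mem_univ k)
      rw [hdd, hQe, e0]; ring
    rw [e, coeff_sub, eq_div_iff hN.ne']
    rw [hc2, h0] at *
    linarith
  have hDx : ∏ i, |(derivative P).eval (x i)| = (n + 2 : ℝ) ^ (n + 2) * ∏ k, |P.eval (z k)| := by
    rw [hd]
    simp only [eval_mul, eval_C, abs_mul, prod_mul_distrib, abs_of_pos hN]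
    simp only [hP, hQ, Lagrange.eval_nodal, abs_prod]
    rw [prod_comm]
    simp [abs_sub_comm]
  rw [hDx]
  simp only [hPd, prod_mul_distrib]
  rw [← mul_assoc]
  have ha := aux_amgm n d hd0
  rw [hsum, div_div] at ha
  gcongr

open Polynomial Finset in
lemma aux_schur (n : ℕ) (x : Fin (n + 1) → ℝ) (hx : StrictMono x) (h0 : ∑ i, x i = 0) :
    ∏ i, |(derivative (Lagrange.nodal univ x)).eval (x i)| ≤
      (∏ j ∈ Icc 2 (n + 1), (j : ℝ) ^ j) *
        ((∑ i, x i ^ 2) / ((n + 1) * n)) ^ ((n + 1) * n / 2) := by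
  induction n with
  | zero => simp [Lagrange.nodal]
  | succ n ih =>
    obtain ⟨z, hz, hz0, hzS, hle⟩ := aux_step n x hx h0
    have h := ih z hz hz0
    set S := ∑ i, x i ^ 2 with hS
    have hS0 : 0 ≤ S := sum_nonneg fun _ _ => sq_nonneg _
    have e1 : ((∑ i, z i ^ 2) / (((n:ℝ) + 1) * n)) ^ ((n + 1) * n / 2) =
       (S / ((n + 2) * (n + 1))) ^ ((n + 1) * n / 2) := by
      rcases Nat.eq_zero_or_pos n with rfl | hn
      · simp
      · congr 1
        have : (0:ℝ) < n := by exact_mod_cast hn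
        field_simp
        linarith
    rw [e1] at h
    have e2 : (n + 1 + 1) * (n + 1) / 2 = (n + 1) + (n + 1) * n / 2 := by
      have : (n + 1 + 1) * (n + 1) = (n+1) * n + (n + 1) * 2 := by ring
      rw [this, Nat.add_mul_div_right _ _ (by norm_num), add_comm]
    rw [e2, prod_Icc_succ_top (by omega)]
    push_cast
    have e3 : (n:ℝ) + 1 + 1 = n + 2 := by ring
    rw [e3]
    refine hle.trans ((mul_le_mul_of_nonneg_left h (by positivity)).trans (le_of_eq ?_))
    rw [pow_add]
    ring

open Polynomial Finset in
lemma aux_disc (N : ℕ) (x : Fin N → ℝ) :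
    ∏ p ∈ univ.filter (fun p : Fin N × Fin N => p.1 < p.2), (x p.1 - x p.2) ^ 2 =
      ∏ i, |(derivative (Lagrange.nodal univ x)).eval (x i)| := by
  have h1 : ∀ i, |(derivative (Lagrange.nodal univ x)).eval (x i)| =
      (∏ j, if i < j then |x i - x j| else 1) * ∏ j, if j < i then |x i - x j| else 1 := by
    intro i
    rw [Lagrange.eval_nodal_derivative_eval_node_eq (mem_univ i), Lagrange.eval_nodal, abs_prod,
      ← prod_mul_distrib, ← mul_prod_erase univ _ (mem_univ i)]
    simp only [lt_irrefl, if_false, one_mul]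
    refine prod_congr rfl fun j hj => ?_
    rcases lt_or_gt_of_ne (ne_of_mem_erase hj) with h | h
    · simp [h, h.not_gt]
    · simp [h, h.not_gt]
  simp only [h1, prod_mul_distrib]
  rw [prod_comm (f := fun i j => if j < i then |x i - x j| else 1), ← prod_mul_distrib,
    prod_filter, ← univ_product_univ, prod_product]
  refine prod_congr rfl fun i _ => ?_
  rw [← prod_mul_distrib]
  refine prod_congr rfl fun j _ => ?_
  by_cases h : i < j
  · simp only [h, if_true]
    rw [abs_sub_comm (x j), ← sq, sq_abs]
  · simp [h]

open Polynomial Finset in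
lemma aux_main (n : ℕ) (x : Fin (n + 1) → ℝ) :
    ∏ p ∈ univ.filter (fun p : Fin (n + 1) × Fin (n + 1) => p.1 < p.2), (x p.1 - x p.2) ^ 2 ≤
      (∏ j ∈ Icc 2 (n + 1), (j : ℝ) ^ j) *
        ((∑ i, x i ^ 2) / ((n + 1) * n)) ^ ((n + 1) * n / 2) := by
  have hS0 : 0 ≤ ∑ i, x i ^ 2 := sum_nonneg fun _ _ => sq_nonneg _
  by_cases hinj : Function.Injective x
  swap
  · rw [aux_disc]
    simp only [Function.Injective] at hinj
    push Not at hinj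
    obtain ⟨i, j, hij, hne⟩ := hinj
    rw [prod_eq_zero (mem_univ i)]
    · positivity
    · rw [Lagrange.eval_nodal_derivative_eval_node_eq (mem_univ i), Lagrange.eval_nodal,
        prod_eq_zero (mem_erase.2 ⟨hne.symm, mem_univ j⟩) (by rw [hij, sub_self]), abs_zero]
  · set m := (∑ i, x i) / (n + 1) with hm
    have hn : (0:ℝ) < n + 1 := by positivity
    have hmm : ∑ i, x i = (n + 1) * m := by rw [hm]; field_simp
    let y : Fin (n+1) → ℝ := fun i => x (Tuple.sort x i) - m
    have hy : StrictMono y := by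
      have h1 : StrictMono (x ∘ Tuple.sort x) :=
        (Tuple.monotone_sort x).strictMono_of_injective (hinj.comp (Equiv.injective _))
      intro a b hab
      exact sub_lt_sub_right (h1 hab) m
    have hy0 : ∑ i, y i = 0 := by
      simp only [y]
      rw [Equiv.sum_comp (Tuple.sort x) (fun i => x i - m), sum_sub_distrib, hmm]
      simp
    have hyS : ∑ i, y i ^ 2 ≤ ∑ i, x i ^ 2 := by
      simp only [y]
      rw [Equiv.sum_comp (Tuple.sort x) (fun i => (x i - m)^2)]
      have : ∑ i, (x i - m)^2 = ∑ i, x i ^ 2 - (n + 1) * m ^ 2 := by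
        have : ∀ i, (x i - m)^2 = x i ^2 - 2 * m * x i + m ^ 2 := fun i => by ring
        simp only [this, sum_add_distrib, sum_sub_distrib, ← mul_sum, hmm]
        simp
        ring
      rw [this]
      nlinarith [sq_nonneg m]
    have h := aux_schur n y hy hy0
    have hS0' : 0 ≤ ∑ i, y i ^ 2 := sum_nonneg fun _ _ => sq_nonneg _
    have e : ∏ i, |(derivative (Lagrange.nodal univ y)).eval (y i)| =
        ∏ i, |(derivative (Lagrange.nodal univ x)).eval (x i)| := by
      rw [← Equiv.prod_comp (Tuple.sort x)
        (fun i => |(derivative (Lagrange.nodal univ x)).eval (x i)|)]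
      refine prod_congr rfl fun i _ => ?_
      rw [Lagrange.eval_nodal_derivative_eval_node_eq (mem_univ _), Lagrange.eval_nodal,
        Lagrange.eval_nodal_derivative_eval_node_eq (mem_univ _), Lagrange.eval_nodal]
      congr 1
      refine prod_bij (fun j _ => Tuple.sort x j) ?_ ?_ ?_ ?_
      · intro j hj
        simpa using hj
      · intro a _ b _ hab
        simpa using hab
      · intro b hb
        refine ⟨(Tuple.sort x).symm b, ?_, by simp⟩
        simp only [mem_erase, mem_univ, and_true] at hb ⊢
        intro h; apply hb; rw [← h]; simp
      · intro j _
        simp [y]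
    rw [aux_disc, ← e]
    refine h.trans ?_
    gcongr

lemma aux_trace (F : Type*) [Field F] [NumberField F]
    (N : ℕ) (hN : N = Module.finrank ℚ F)
    (e : Fin N ≃ (F →+* ℝ)) (a : F) :
    ((Algebra.trace ℚ F a : ℚ) : ℝ) = ∑ i, e i a := by
  have h := trace_eq_sum_embeddings (K := ℚ) (L := F) ℂ (x := a)
  let f : Fin N → (F →ₐ[ℚ] ℂ) := fun i => (Complex.ofRealHom.comp (e i)).toRatAlgHom
  have hf : Function.Injective f := by
    intro i j hij
    apply e.injective
    ext b
    have := DFunLike.congr_fun hij b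
    simpa [f] using this
  have hb : Function.Bijective f := by
    rw [Fintype.bijective_iff_injective_and_card]
    refine ⟨hf, ?_⟩
    rw [AlgHom.card, Fintype.card_fin, hN]
  rw [← hb.sum_comp (fun σ : F →ₐ[ℚ] ℂ => σ a)] at h
  apply Complex.ofReal_injective
  simpa [f] using h

theorem stmt6 (F : Type*) [Field F] [NumberField F]
    (N : ℕ) (hN : N = Module.finrank ℚ F)
    (htr : Fintype.card (F →+* ℝ) = N)
    (e : Fin N ≃ (F →+* ℝ))
    (β : F) (hβ : IsIntegral ℤ β) (hβ0 : β ≠ 0)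
    (c Δ : ℝ)
    (hc : c = ((N : ℝ) ^ 2 - N) /
        (∏ j ∈ Finset.Icc 2 N, (j : ℝ) ^ j) ^ ((2 : ℝ) / ((N : ℝ) ^ 2 - N)))
    (hΔ : Δ = ∏ p ∈ Finset.univ.filter (fun p : Fin N × Fin N => p.1 < p.2),
        (e p.1 β - e p.2 β) ^ 2) :
    c * Δ ^ ((2 : ℝ) / ((N : ℝ) ^ 2 - N)) ≤ ((Algebra.trace ℚ F (β ^ 2) : ℚ) : ℝ) := by
  rw [aux_trace F N hN e]
  simp only [map_pow]
  have hS0 : 0 ≤ ∑ i, (e i β) ^ 2 := Finset.sum_nonneg fun _ _ => sq_nonneg _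
  have hN0 : 0 < N := hN ▸ Module.finrank_pos
  obtain ⟨n, rfl⟩ : ∃ n, N = n + 1 := ⟨N - 1, by omega⟩
  rcases Nat.eq_zero_or_pos n with rfl | hn
  · rw [hc]
    simpa using hS0
  have hm := aux_main n (fun i => e i β)
  rw [← hΔ] at hm
  have hΔ0 : 0 ≤ Δ := hΔ ▸ Finset.prod_nonneg fun _ _ => sq_nonneg _
  have hn' : (0:ℝ) < n := by exact_mod_cast hn
  set A := ∏ j ∈ Finset.Icc 2 (n + 1), (j : ℝ) ^ j with hA
  set S := ∑ i, (e i β) ^ 2 with hS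
  have hA0 : 0 < A := Finset.prod_pos fun j hj => by
    have : 0 < j := by have := (Finset.mem_Icc.1 hj).1; omega
    positivity
  have e1 : (((n + 1 : ℕ) : ℝ) ^ 2 - (n + 1 : ℕ)) = (n + 1) * n := by push_cast; ring
  rw [e1] at hc ⊢
  set r : ℝ := 2 / ((n + 1) * n) with hr
  have hr0 : 0 < r := by positivity
  have hmr : (((n + 1) * n / 2 : ℕ) : ℝ) * r = 1 := by
    rw [Nat.cast_div (even_iff_two_dvd.1 (by rw [mul_comm]; exact Nat.even_mul_succ_self n)) (by norm_num)]
    rw [hr]; push_cast; field_simp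
  have h1 : Δ ^ r ≤ A ^ r * (S / ((n + 1) * n)) := by
    have := Real.rpow_le_rpow hΔ0 hm hr0.le
    rwa [Real.mul_rpow hA0.le (by positivity), ← Real.rpow_natCast, ← Real.rpow_mul (by positivity),
      hmr, Real.rpow_one] at this
  have hAr : 0 < A ^ r := Real.rpow_pos_of_pos hA0 r
  rw [hc]
  calc ((n:ℝ) + 1) * n / A ^ r * Δ ^ r ≤ (n + 1) * n / A ^ r * (A ^ r * (S / ((n + 1) * n))) := by
        gcongr
    _ = S := by field_simp
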